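/- arXiv:2103.10682 — 2 statements merged into one kernel-verified Lean document; each statement's English description precedes it below -/
import Mathlib

section
/- (Proposition 1, equation (7)) For any finite nonempty family of training samples, each with logits lₖ and a legal ground-truth path yₖ, and any transition matrix A₀, the CRF loss under the masked transition matrix converges to the masked-CRF loss: ℒ(Ā(A₀, c)) → ℒ'(A₀) as c → -∞. -/
open Finset Filter Topology

/-- The score of a path `p` given emission logits `l` and transition matrix `A`:
the sum of emission scores plus the sum of transition scores over consecutive pairs. -/
def score {n d : ℕ} (l : Fin (n + 1) → Fin d → ℝ) (A : Fin d → Fin d → ℝ)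
    (p : Fin (n + 1) → Fin d) : ℝ :=
  (∑ i, l i (p i)) + ∑ i : Fin n, A (p i.castSucc) (p i.succ)

/-- The masked transition matrix: entries in the illegal set `Ω` are replaced by `c`. -/
def masked {d : ℕ} (Ω : Finset (Fin d × Fin d)) (A : Fin d → Fin d → ℝ) (c : ℝ) :
    Fin d → Fin d → ℝ :=
  fun i j => if (i, j) ∈ Ω then c else A i j

/-- A path is legal if it contains no illegal transition. -/
def Legal {n d : ℕ} (Ω : Finset (Fin d × Fin d)) (p : Fin (n + 1) → Fin d) : Prop :=
  ∀ i : Fin n, (p i.castSucc, p i.succ) ∉ Ω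

instance {n d : ℕ} (Ω : Finset (Fin d × Fin d)) : DecidablePred (Legal (n := n) Ω) :=
  fun _ => by unfold Legal; infer_instance

/-- Partition function: sum of exponentiated scores over all paths. -/
noncomputable def partAll {n d : ℕ} (l : Fin (n + 1) → Fin d → ℝ)
    (A : Fin d → Fin d → ℝ) : ℝ :=
  ∑ p : Fin (n + 1) → Fin d, Real.exp (score l A p)

/-- Restricted partition function: sum of exponentiated scores over legal paths. -/
noncomputable def partLegal {n d : ℕ} (Ω : Finset (Fin d × Fin d))
    (l : Fin (n + 1) → Fin d → ℝ) (A : Fin d → Fin d → ℝ) : ℝ :=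
  ∑ p ∈ Finset.univ.filter (Legal Ω), Real.exp (score l A p)

/-- The CRF likelihood of a ground-truth path `y`. -/
noncomputable def Lik {n d : ℕ} (y : Fin (n + 1) → Fin d) (l : Fin (n + 1) → Fin d → ℝ)
    (A : Fin d → Fin d → ℝ) : ℝ :=
  Real.exp (score l A y) / partAll l A

/-- The masked-CRF likelihood of a ground-truth path `y`. -/
noncomputable def LikM {n d : ℕ} (Ω : Finset (Fin d × Fin d)) (y : Fin (n + 1) → Fin d)
    (l : Fin (n + 1) → Fin d → ℝ) (A : Fin d → Fin d → ℝ) : ℝ :=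
  Real.exp (score l A y) / partLegal Ω l A

/-- The CRF loss over a family of `N` training samples. -/
noncomputable def crfLoss {n d : ℕ} (N : ℕ) (l : Fin N → Fin (n + 1) → Fin d → ℝ)
    (y : Fin N → Fin (n + 1) → Fin d) (A : Fin d → Fin d → ℝ) : ℝ :=
  -(1 / (N : ℝ)) * ∑ k, Real.log (Lik (y k) (l k) A)

/-- The masked-CRF loss over a family of `N` training samples. -/
noncomputable def mcrfLoss {n d : ℕ} (Ω : Finset (Fin d × Fin d)) (N : ℕ)
    (l : Fin N → Fin (n + 1) → Fin d → ℝ) (y : Fin N → Fin (n + 1) → Fin d)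
    (A : Fin d → Fin d → ℝ) : ℝ :=
  -(1 / (N : ℝ)) * ∑ k, Real.log (LikM Ω (y k) (l k) A)

theorem score_masked {n d : ℕ} (Ω : Finset (Fin d × Fin d)) (l : Fin (n + 1) → Fin d → ℝ)
    (A : Fin d → Fin d → ℝ) (c : ℝ) (p : Fin (n + 1) → Fin d) :
    score l (masked Ω A c) p = score l (masked Ω A 0) p +
      (#{i : Fin n | (p i.castSucc, p i.succ) ∈ Ω} : ℝ) * c := by
  have h : ∑ i : Fin n, masked Ω A c (p i.castSucc) (p i.succ) =
      ∑ i : Fin n, (masked Ω A 0 (p i.castSucc) (p i.succ) +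
        if (p i.castSucc, p i.succ) ∈ Ω then c else 0) := by
    refine sum_congr rfl fun i _ => ?_
    unfold masked
    split_ifs <;> simp
  rw [score, score, h, sum_add_distrib, ← sum_filter, sum_const, nsmul_eq_mul, add_assoc]

theorem Legal.score_masked {n d : ℕ} {Ω : Finset (Fin d × Fin d)} {p : Fin (n + 1) → Fin d}
    (hp : Legal Ω p) (l : Fin (n + 1) → Fin d → ℝ) (A : Fin d → Fin d → ℝ) (c : ℝ) :
    score l (masked Ω A c) p = score l A p := by
  unfold score masked
  exact congrArg _ (sum_congr rfl fun i _ => if_neg (hp i))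

theorem tendsto_score_masked_atBot {n d : ℕ} {Ω : Finset (Fin d × Fin d)}
    {p : Fin (n + 1) → Fin d} (hp : ¬ Legal Ω p) (l : Fin (n + 1) → Fin d → ℝ)
    (A : Fin d → Fin d → ℝ) :
    Tendsto (fun c => score l (masked Ω A c) p) atBot atBot := by
  rw [funext fun c => score_masked Ω l A c p]
  refine tendsto_atBot_add_const_left _ _ (tendsto_id.const_mul_atBot ?_)
  unfold Legal at hp
  push Not at hp
  obtain ⟨i, hi⟩ := hp
  exact_mod_cast card_pos.mpr ⟨i, by simpa using hi⟩

theorem tendsto_partAll_masked {n d : ℕ} (Ω : Finset (Fin d × Fin d))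
    (l : Fin (n + 1) → Fin d → ℝ) (A : Fin d → Fin d → ℝ) :
    Tendsto (fun c => partAll l (masked Ω A c)) atBot (𝓝 (partLegal Ω l A)) := by
  unfold partAll partLegal
  rw [sum_filter]
  refine tendsto_finsetSum _ fun p _ => ?_
  split_ifs with hp
  · simp only [hp.score_masked]
    exact tendsto_const_nhds
  · exact Real.tendsto_exp_atBot.comp (tendsto_score_masked_atBot hp l A)

theorem Legal.partLegal_pos {n d : ℕ} {Ω : Finset (Fin d × Fin d)} {p : Fin (n + 1) → Fin d}
    (hp : Legal Ω p) (l : Fin (n + 1) → Fin d → ℝ) (A : Fin d → Fin d → ℝ) :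
    0 < partLegal Ω l A :=
  sum_pos (fun _ _ => Real.exp_pos _) ⟨p, by simpa using hp⟩

theorem Legal.tendsto_lik_masked {n d : ℕ} {Ω : Finset (Fin d × Fin d)}
    {y : Fin (n + 1) → Fin d} (hy : Legal Ω y) (l : Fin (n + 1) → Fin d → ℝ)
    (A : Fin d → Fin d → ℝ) :
    Tendsto (fun c => Lik y l (masked Ω A c)) atBot (𝓝 (LikM Ω y l A)) := by
  unfold Lik LikM
  simp only [hy.score_masked]
  exact tendsto_const_nhds.div (tendsto_partAll_masked Ω l A) (hy.partLegal_pos l A).ne'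

/-- Proposition 1, (7): for a finite nonempty family of samples with legal
ground-truth paths, `ℒ(Ā(A₀, c)) → ℒ'(A₀)` as `c → -∞`. -/
theorem stmt_7 {n d : ℕ} (hd : 1 ≤ d) (Ω : Finset (Fin d × Fin d))
    (N : ℕ) (hN : 1 ≤ N)
    (l : Fin N → Fin (n + 1) → Fin d → ℝ) (y : Fin N → Fin (n + 1) → Fin d)
    (hy : ∀ k, Legal Ω (y k)) (A₀ : Fin d → Fin d → ℝ) :
    Tendsto (fun c : ℝ => crfLoss N l y (masked Ω A₀ c)) atBot
      (𝓝 (mcrfLoss Ω N l y A₀)) := by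
  refine (tendsto_finsetSum _ fun k _ => ?_).const_mul _
  exact ((hy k).tendsto_lik_masked (l k) A₀).log
    (div_pos (Real.exp_pos _) ((hy k).partLegal_pos (l k) A₀)).ne'
end

section
/- Let l : E → Fin T → Fin d → ℝ be differentiable at W₀ ∈ E. Then the Fréchet derivative at W₀ of the map W ↦ ∑ over all paths p of exp(s(p, l W, Ā(A₀, c))) converges, in operator norm, to the Fréchet derivative at W₀ of the map W ↦ ∑ over all legal paths p of exp(s(p, l W, A₀)) as c → -∞. -/
open Finset Filter Topology

theorem score_masked_of_legal {n d : ℕ} {Ω : Finset (Fin d × Fin d)}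
    (l : Fin (n + 1) → Fin d → ℝ) (A : Fin d → Fin d → ℝ) (c : ℝ)
    {p : Fin (n + 1) → Fin d} (hp : Legal Ω p) :
    score l (masked Ω A c) p = score l A p := by
  unfold score masked
  congr 1
  exact Finset.sum_congr rfl fun i _ => if_neg (hp i)

theorem tendsto_score_masked_of_not_legal {n d : ℕ} {Ω : Finset (Fin d × Fin d)}
    (l : Fin (n + 1) → Fin d → ℝ) (A : Fin d → Fin d → ℝ)
    {p : Fin (n + 1) → Fin d} (hp : ¬ Legal Ω p) :
    Tendsto (fun c => score l (masked Ω A c) p) atBot atBot := by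
  obtain ⟨k, hk⟩ : ∃ k : Fin n, (p k.castSucc, p k.succ) ∈ Ω := by
    simpa [Legal] using hp
  unfold score
  refine tendsto_atBot_add_const_left _ _ ?_
  have hbound : ∀ᶠ c : ℝ in atBot,
      ∑ i : Fin n, masked Ω A c (p i.castSucc) (p i.succ) ≤
        c + ∑ i ∈ Finset.univ.erase k, |A (p i.castSucc) (p i.succ)| := by
    filter_upwards [eventually_le_atBot 0] with c hc
    rw [← Finset.add_sum_erase _ _ (Finset.mem_univ k)]
    refine add_le_add (by simp [masked, hk]) (Finset.sum_le_sum fun i _ => ?_)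
    unfold masked
    split_ifs
    · exact hc.trans (abs_nonneg _)
    · exact le_abs_self _
  exact tendsto_atBot_mono' _ hbound (tendsto_atBot_add_const_right _ _ tendsto_id)

theorem tendsto_exp_score_masked {n d : ℕ} (Ω : Finset (Fin d × Fin d))
    (l : Fin (n + 1) → Fin d → ℝ) (A : Fin d → Fin d → ℝ) (p : Fin (n + 1) → Fin d) :
    Tendsto (fun c => Real.exp (score l (masked Ω A c) p)) atBot
      (𝓝 (if Legal Ω p then Real.exp (score l A p) else 0)) := by
  split_ifs with hp
  · simp only [score_masked_of_legal l A _ hp, tendsto_const_nhds]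
  · exact Real.tendsto_exp_atBot.comp (tendsto_score_masked_of_not_legal l A hp)

theorem hasFDerivAt_exp_score {E : Type*} [NormedAddCommGroup E] [NormedSpace ℝ E]
    {n d : ℕ} {l : E → Fin (n + 1) → Fin d → ℝ} {W : E} (hl : DifferentiableAt ℝ l W)
    (A : Fin d → Fin d → ℝ) (p : Fin (n + 1) → Fin d) :
    HasFDerivAt (fun V => Real.exp (score (l V) A p))
      (Real.exp (score (l W) A p) • ∑ i, fderiv ℝ (fun V => l V i (p i)) W) W := by
  have hcoord : ∀ i, DifferentiableAt ℝ (fun V => l V i (p i)) W := fun i =>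
    differentiableAt_pi.1 (differentiableAt_pi.1 hl i) (p i)
  exact ((HasFDerivAt.fun_sum fun i _ => (hcoord i).hasFDerivAt).add_const _).exp

/-- the Fréchet derivative at `W₀` of the masked partition function
converges in operator norm to the Fréchet derivative of the legal-paths partition
function as `c → -∞`. -/
theorem stmt_13 {E : Type*} [NormedAddCommGroup E] [NormedSpace ℝ E]
    {n d : ℕ} (hd : 1 ≤ d) (Ω : Finset (Fin d × Fin d))
    (l : E → Fin (n + 1) → Fin d → ℝ) (W₀ : E) (hl : DifferentiableAt ℝ l W₀)
    (A₀ : Fin d → Fin d → ℝ) :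
    Tendsto (fun c : ℝ =>
        fderiv ℝ (fun W => partAll (l W) (masked Ω A₀ c)) W₀) atBot
      (𝓝 (fderiv ℝ (fun W => partLegal Ω (l W) A₀) W₀)) := by
  have hall : ∀ A, fderiv ℝ (fun W => partAll (l W) A) W₀ =
      ∑ p : Fin (n + 1) → Fin d,
        Real.exp (score (l W₀) A p) • ∑ i, fderiv ℝ (fun V => l V i (p i)) W₀ := fun A =>
    (HasFDerivAt.fun_sum fun p _ => hasFDerivAt_exp_score hl A p).fderiv
  have hlegal : fderiv ℝ (fun W => partLegal Ω (l W) A₀) W₀ =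
      ∑ p : Fin (n + 1) → Fin d, (if Legal Ω p then Real.exp (score (l W₀) A₀ p) else 0) •
        ∑ i, fderiv ℝ (fun V => l V i (p i)) W₀ := by
    simp only [ite_smul, zero_smul, ← Finset.sum_filter]
    exact (HasFDerivAt.fun_sum fun p _ => hasFDerivAt_exp_score hl A₀ p).fderiv
  simp only [hall, hlegal]
  exact tendsto_finsetSum _ fun p _ =>
    (tendsto_exp_score_masked Ω (l W₀) A₀ p).smul_const _
end
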